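/- arXiv:1709.00313 — 2 statements merged into one kernel-verified Lean document; each statement's English description precedes it below -/
import Mathlib

section
/- Let P = (X, ≺) be a finite partially ordered set and let k be a positive integer. Then P has a [1,k]-interval representation if and only if P contains no induced copy of the poset 2+2 and no induced copy of the poset (k+2)+1. -/
/-- A weighted digraph on vertex set `V`: an adjacency (arc) relation and a
real weight on each (potential) arc. -/
structure WeightedDigraph (V : Type*) where
  Adj : V → V → Prop
  w : V → V → ℝ

/-- A potential function: `p y - p x ≤ w x y` for every arc `(x, y)`. -/
def WeightedDigraph.IsPotential {V : Type*} (G : WeightedDigraph V) (p : V → ℝ) : Prop :=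
  ∀ u v, G.Adj u v → p v - p u ≤ G.w u v

/-- Cyclic successor of an index. -/
def finNext {n : ℕ} (i : Fin n) : Fin n := ⟨(i + 1) % n, Nat.mod_lt _ i.pos⟩

/-- A cycle: a nonempty list of distinct vertices, with an arc from each
vertex to the (cyclically) next one. -/
def WeightedDigraph.IsCycle {V : Type*} (G : WeightedDigraph V) (c : List V) : Prop :=
  c ≠ [] ∧ c.Nodup ∧ ∀ i : Fin c.length, G.Adj (c.get i) (c.get (finNext i))

/-- The weight of a cycle: the sum of its arc weights. -/
def WeightedDigraph.cycleWeight {V : Type*} (G : WeightedDigraph V) (c : List V) : ℝ :=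
  ∑ i : Fin c.length, G.w (c.get i) (c.get (finNext i))

/-- `G` has a negative cycle. -/
def WeightedDigraph.HasNegCycle {V : Type*} (G : WeightedDigraph V) : Prop :=
  ∃ c : List V, G.IsCycle c ∧ G.cycleWeight c < 0

/-- `x` and `y` are distinct and incomparable. -/
def Incomp {X : Type*} [PartialOrder X] (x y : X) : Prop :=
  x ≠ y ∧ ¬ x < y ∧ ¬ y < x

/-- The weighted digraph `G_{P,k}` associated to the finite poset `X` and the
parameters `k` and `ε`.  The left copy `Sum.inl x` plays the role of `ℓ_x`,
and the right copy `Sum.inr x` plays the role of `r_x`.  Arcs: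
`(ℓ_y, r_x)` of weight `-ε` when `x ≺ y`; `(ℓ_x, r_x)` of weight `k`;
`(r_x, ℓ_y)` of weight `0` when `x, y` are distinct and incomparable;
`(r_x, ℓ_x)` of weight `-1`. -/
def GPk (X : Type*) [PartialOrder X] [DecidableEq X] (k : ℕ) (ε : ℝ) :
    WeightedDigraph (X ⊕ X) where
  Adj u v :=
    match u, v with
    | .inl y, .inr x => x < y ∨ x = y
    | .inr x, .inl y => Incomp x y ∨ x = y
    | _, _ => False
  w u v :=
    match u, v with
    | .inl y, .inr x => if x = y then (k : ℝ) else -ε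
    | .inr x, .inl y => if x = y then -1 else 0
    | _, _ => 0

/-- `L, R` give an interval representation of the poset `X`: each `x` gets the
closed interval `[L x, R x]`, and `x ≺ y` iff the interval of `x` lies
entirely to the left of the interval of `y`. -/
def IsIntervalRep {X : Type*} [PartialOrder X] (L R : X → ℝ) : Prop :=
  (∀ x, L x ≤ R x) ∧ ∀ x y, x < y ↔ R x < L y

/-- The poset `X` has an interval representation with all lengths in `[1, k]`. -/
def HasIntervalRep1k (X : Type*) [PartialOrder X] (k : ℕ) : Prop :=
  ∃ L R : X → ℝ, IsIntervalRep L R ∧ ∀ x, 1 ≤ R x - L x ∧ R x - L x ≤ (k : ℝ)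

/-- `X` contains an induced copy of `2 + 2`: elements `a, b, c, d` whose only
comparabilities are `a ≺ c` and `b ≺ d`. -/
def HasInduced22 (X : Type*) [PartialOrder X] : Prop :=
  ∃ a b c d : X, a < c ∧ b < d ∧ Incomp a b ∧ Incomp a d ∧ Incomp b c ∧ Incomp c d

/-- `X` contains an induced copy of `n + 1`: a chain `a 0 ≺ a 1 ≺ ⋯ ≺ a (n-1)`
together with an element `x` incomparable to every element of the chain. -/
def HasInducedChainPlus1 (X : Type*) [PartialOrder X] (n : ℕ) : Prop :=
  ∃ (a : ℕ → X) (x : X), (∀ i j, i < j → j < n → a i < a j) ∧ ∀ i < n, Incomp x (a i)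

namespace FishburnAux

/-- weighted walks along a set of weighted arcs -/
inductive Walk {V : Type*} (E : Set (V × V × ℤ)) : V → V → ℤ → Prop
  | single {u v w} : (u, v, w) ∈ E → Walk E u v w
  | snoc {u v w x t} : Walk E u v w → (v, x, t) ∈ E → Walk E u x (w + t)

theorem Walk.trans {V : Type*} {E : Set (V × V × ℤ)} {u v x : V} {s t : ℤ}
    (h1 : Walk E u v s) (h2 : Walk E v x t) : Walk E u x (s + t) := by
  induction h2 with
  | single h => exact h1.snoc h
  | snoc _ h ih => rw [← add_assoc]; exact ih.snoc h

/-- composite arcs through `x` -/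
def elim {V : Type*} (E : Set (V × V × ℤ)) (x : V) : Set (V × V × ℤ) :=
  E ∪ (fun q : (V × V × ℤ) × (V × V × ℤ) => (q.1.1, q.2.2.1, q.1.2.2 + q.2.2.2)) ''
    ({q | q ∈ E ×ˢ E ∧ q.1.2.1 = x ∧ q.2.1 = x})

theorem walk_of_elim {V : Type*} {E : Set (V × V × ℤ)} {x : V} {u v : V} {w : ℤ}
    (h : Walk (elim E x) u v w) : Walk E u v w := by
  have key : ∀ u v w, (u, v, w) ∈ elim E x → Walk E u v w := by
    intro u v w h
    rcases h with h | ⟨⟨⟨a, b, c⟩, ⟨a', b', c'⟩⟩, ⟨⟨h1, h2⟩, h3, h4⟩, h5⟩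
    · exact .single h
    · simp only [Prod.mk.injEq] at h1 h2 h3 h4 h5
      obtain ⟨rfl, rfl, rfl⟩ := h5
      subst h3
      subst h4
      exact (Walk.single h1).snoc h2
  induction h with
  | single h => exact key _ _ _ h
  | snoc _ h ih => exact ih.trans (key _ _ _ h)

theorem exists_potential {V : Type*} [DecidableEq V] (S : Finset V) :
    ∀ E : Set (V × V × ℤ), E.Finite → (∀ u w, Walk E u u w → 0 < w) →
      ∃ p : V → ℝ, ∀ u v w, (u, v, w) ∈ E → u ∈ S → v ∈ S → p v < p u + w := by
  induction S using Finset.induction_on with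
  | empty => intro E _ _; exact ⟨fun _ => 0, by simp⟩
  | insert x S hx ih =>
    intro E hE hpos
    have hfin : (elim E x).Finite := by
      refine hE.union (Set.Finite.image _ ((hE.prod hE).subset ?_))
      intro q hq
      exact hq.1
    obtain ⟨p, hp⟩ := ih (elim E x) hfin (fun u w h => hpos u w (walk_of_elim h))
    -- uppers and lowers for the new value
    let U : Set ℝ := (fun q : V × V × ℤ => p q.1 + q.2.2) '' {q | q ∈ E ∧ q.1 ∈ S ∧ q.2.1 = x}
    let D : Set ℝ := (fun q : V × V × ℤ => p q.2.1 - q.2.2) '' {q | q ∈ E ∧ q.2.1 ∈ S ∧ q.1 = x}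
    have hU : U.Finite := Set.Finite.image _ (hE.subset fun q hq => hq.1)
    have hD : D.Finite := Set.Finite.image _ (hE.subset fun q hq => hq.1)
    obtain ⟨t, ht1, ht2⟩ := Order.exists_between_finsets (lo := hD.toFinset) (hi := hU.toFinset) (by
      intro a ha b hb
      rw [Set.Finite.mem_toFinset] at ha hb
      obtain ⟨⟨a1, a2, a3⟩, ⟨ha1, ha2, ha3⟩, rfl⟩ := ha
      obtain ⟨⟨b1, b2, b3⟩, ⟨hb1, hb2, hb3⟩, rfl⟩ := hb
      simp only at *
      have := hp b1 a2 (b3 + a3) (Or.inr ⟨((b1, b2, b3), (a1, a2, a3)),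
        ⟨⟨hb1, ha1⟩, hb3, ha3⟩, rfl⟩) hb2 ha2
      push_cast at this
      linarith)
    refine ⟨Function.update p x t, ?_⟩
    intro u v w he hu hv
    by_cases hux : u = x
    · by_cases hvx : v = x
      · subst hux; subst hvx
        have := hpos _ _ (.single he)
        have : (0 : ℝ) < w := by exact_mod_cast this
        linarith
      · have hvS : v ∈ S := (Finset.mem_insert.1 hv).resolve_left hvx
        have := ht1 (p v - w) ((Set.Finite.mem_toFinset _).2 ⟨(u, v, w), ⟨he, hvS, hux⟩, rfl⟩)
        subst hux
        rw [Function.update_self, Function.update_of_ne hvx]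
        linarith
    · have huS : u ∈ S := (Finset.mem_insert.1 hu).resolve_left hux
      by_cases hvx : v = x
      · have := ht2 (p u + w) ((Set.Finite.mem_toFinset _).2 ⟨(u, v, w), ⟨he, huS, hvx⟩, rfl⟩)
        subst hvx
        rw [Function.update_self, Function.update_of_ne hux]
        linarith
      · have hvS : v ∈ S := (Finset.mem_insert.1 hv).resolve_left hvx
        rw [Function.update_of_ne hux, Function.update_of_ne hvx]
        exact hp u v w (Or.inl he) huS hvS

section poset
variable {X : Type*} [PartialOrder X]

/-- descending chain with `n` steps from `z` to `x` -/
def Ch : ℕ → X → X → Prop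
  | 0, z, x => z = x
  | n + 1, z, x => ∃ y, y < z ∧ Ch n y x

theorem Ch.trans {m n : ℕ} {z y x : X} (h1 : Ch m z y) (h2 : Ch n y x) : Ch (m + n) z x := by
  induction m generalizing z with
  | zero => cases h1; simpa using h2
  | succ m ih =>
    obtain ⟨a, ha, h⟩ := h1
    rw [Nat.succ_add]
    exact ⟨a, ha, ih h⟩

theorem Ch.split {m n : ℕ} {z x : X} (h : Ch (m + n) z x) : ∃ y, Ch m z y ∧ Ch n y x := by
  induction m generalizing z with
  | zero => exact ⟨z, rfl, by simpa using h⟩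
  | succ m ih =>
    rw [Nat.succ_add] at h
    obtain ⟨a, ha, h⟩ := h
    obtain ⟨y, h1, h2⟩ := ih h
    exact ⟨y, ⟨a, ha, h1⟩, h2⟩

theorem Ch.le {n : ℕ} {z x : X} (h : Ch n z x) : x ≤ z := by
  induction n generalizing z with
  | zero => cases h; exact le_rfl
  | succ n ih => obtain ⟨a, ha, h⟩ := h; exact (ih h).trans ha.le

theorem Ch.lt {n : ℕ} {z x : X} (h : Ch (n + 1) z x) : x < z := by
  obtain ⟨a, ha, h⟩ := h; exact h.le.trans_lt ha

theorem Ch.fn {n : ℕ} {z x : X} (h : Ch n z x) :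
    ∃ f : ℕ → X, f 0 = z ∧ f n = x ∧ ∀ i j, i < j → j ≤ n → f j < f i := by
  induction n generalizing z with
  | zero => exact ⟨fun _ => z, rfl, h, by intro i j h1 h2; omega⟩
  | succ n ih =>
    obtain ⟨a, ha, h⟩ := h
    obtain ⟨f, h0, hn, hf⟩ := ih h
    refine ⟨fun i => if i = 0 then z else f (i - 1), by simp, by simpa using hn, ?_⟩
    intro i j hij hj
    have hj0 : j ≠ 0 := by omega
    by_cases hi : i = 0
    · simp only [hi, hj0, if_true, if_false]
      by_cases hj1 : j - 1 = 0
      · rw [hj1, h0]; exact ha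
      · have := hf 0 (j - 1) (by omega) (by omega)
        rw [h0] at this
        exact this.trans ha
    · simp only [hi, hj0, if_false]
      exact hf _ _ (by omega) (by omega)

theorem chain_lt {k : ℕ} (hc : ¬ HasInducedChainPlus1 X (k + 2)) {p z x : X}
    (h : Ch (k + 1) z x) (hp : ¬ p < z) : x < p := by
  by_contra hx
  apply hc
  obtain ⟨f, h0, hn, hf⟩ := h.fn
  refine ⟨fun i => f (k + 1 - i), p, ?_, ?_⟩
  · intro i j hij hj
    exact hf _ _ (by omega) (by omega)
  · intro i hi
    have key : ∀ j ≤ k + 1, Incomp p (f j) := by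
      intro j hj
      have hz : f j ≤ z := by
        rcases Nat.eq_zero_or_pos j with h | h
        · rw [h, h0]
        · rw [← h0]; exact (hf _ _ h hj).le
      have hx' : x ≤ f j := by
        rcases hj.eq_or_lt with h | h
        · rw [h, hn]
        · rw [← hn]; exact (hf _ _ h le_rfl).le
      refine ⟨?_, fun h => hp (h.trans_le hz), fun h => hx (hx'.trans_lt h)⟩
      rintro rfl
      rcases hz.lt_or_eq with h' | h'
      · exact hp h'
      · exact hx (h' ▸ h.lt)
    exact key _ (by omega)

theorem ferrers (h22 : ¬ HasInduced22 X) {a b c d : X} (h1 : a < c) (h2 : b < d)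
    (h3 : ¬ a < d) : b < c := by
  by_contra h4
  apply h22
  refine ⟨a, b, c, d, h1, h2, ⟨?_, ?_, ?_⟩, ⟨?_, h3, ?_⟩, ⟨?_, h4, ?_⟩, ⟨?_, ?_, ?_⟩⟩
  · rintro rfl; exact h3 h2
  · intro h; exact h3 (h.trans h2)
  · intro h; exact h4 (h.trans h1)
  · rintro rfl; exact h4 (h2.trans h1)
  · intro h; exact h4 (h2.trans (h.trans h1))
  · rintro rfl; exact h3 (h1.trans h2)
  · intro h; exact h3 (h1.trans (h.trans h2))
  · rintro rfl; exact h3 h1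
  · intro h; exact h3 (h1.trans h)
  · intro h; exact h4 (h2.trans h)

/-- a descending walk with `n` unit steps, possibly trivial -/
def Desc (z w : X) (n : ℕ) : Prop := Ch n z w ∨ ∃ x, Ch (n + 1) z x ∧ ¬ x < w

/-- a nontrivial descending walk with `n` unit steps -/
def DescP (z w : X) (n : ℕ) : Prop := (1 ≤ n ∧ Ch n z w) ∨ ∃ x, Ch (n + 1) z x ∧ ¬ x < w

theorem DescP.desc {z w : X} {n : ℕ} (h : DescP z w n) : Desc z w n := h.imp And.right id

theorem descP_irrefl {z : X} {n : ℕ} (h : DescP z z n) : False := by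
  rcases h with ⟨h1, h⟩ | ⟨x, h, hx⟩
  · obtain ⟨m, rfl⟩ := Nat.exists_eq_add_of_le' h1
    exact lt_irrefl _ h.lt
  · exact hx h.lt

theorem glue (h22 : ¬ HasInduced22 X) {z x w v : X} {n m : ℕ} (h : Ch (n + 1) z x)
    (hx : ¬ x < w) (h' : Ch (m + 1) w v) : Ch (n + (m + 1)) z v := by
  obtain ⟨y, h1, h2⟩ := h.split
  obtain ⟨a, ha, rfl⟩ := h2
  obtain ⟨b, hb, h3⟩ := h'
  exact h1.trans ⟨b, ferrers h22 ha hb hx, h3⟩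

theorem Desc.trans (h22 : ¬ HasInduced22 X) {z w v : X} {n m : ℕ} (h1 : Desc z w n)
    (h2 : Desc w v m) : Desc z v (n + m) := by
  rcases h1 with h1 | ⟨x, h1, hx⟩
  · rcases h2 with h2 | ⟨y, h2, hy⟩
    · exact Or.inl (h1.trans h2)
    · exact Or.inr ⟨y, h1.trans h2, hy⟩
  · rcases h2 with h2 | ⟨y, h2, hy⟩
    · cases m with
      | zero => cases h2; exact Or.inr ⟨x, h1, hx⟩
      | succ m => exact Or.inl (glue h22 h1 hx h2)
    · have h3 : Ch (n + (m + 1)) z y := glue h22 h1 hx h2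
      exact Or.inr ⟨y, h3, hy⟩

theorem DescP.trans (h22 : ¬ HasInduced22 X) {z w v : X} {n m : ℕ} (h1 : DescP z w n)
    (h2 : DescP w v m) : DescP z v (n + m) := by
  rcases h1.desc.trans h22 h2.desc with h | h
  · rcases Nat.eq_zero_or_pos (n + m) with h0 | h0
    · obtain ⟨rfl, rfl⟩ : n = 0 ∧ m = 0 := by omega
      rcases h1 with ⟨h1, _⟩ | ⟨x, hx, hx'⟩
      · omega
      rcases h2 with ⟨h2, _⟩ | ⟨y, hy, hy'⟩
      · omega
      cases h
      exact Or.inr ⟨y, glue h22 hx hx' hy, hy'⟩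
    · exact Or.inl ⟨h0, h⟩
  · exact Or.inr h

/-- one ascending arc (weight `k`) followed by a descending walk -/
def Seg (k : ℕ) (y w : X) (s : ℤ) : Prop :=
  ∃ z n, ¬ y < z ∧ Desc z w n ∧ s = (k : ℤ) - n

theorem Seg.append {k : ℕ} (h22 : ¬ HasInduced22 X) {y w v : X} {s : ℤ} {n : ℕ}
    (h : Seg k y w s) (h2 : Desc w v n) : Seg k y v (s - n) := by
  obtain ⟨z, m, h0, h1, rfl⟩ := h
  exact ⟨z, m + n, h0, h1.trans h22 h2, by push_cast; ring⟩

theorem Seg.reduce {k : ℕ} (hk : 0 < k) (hc : ¬ HasInducedChainPlus1 X (k + 2))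
    {p q : X} {t : ℤ} (h : Seg k p q t) (ht : t ≤ 0) :
    (∃ n : ℕ, DescP p q n ∧ t = -n) ∨ (t = 0 ∧ ∃ z, q < z ∧ ¬ p < z) := by
  obtain ⟨z, n, h0, h1, rfl⟩ := h
  have hn : k ≤ n := by omega
  obtain ⟨m, rfl⟩ := Nat.exists_eq_add_of_le hn
  rcases h1 with h1 | ⟨x, h1, hx⟩
  · cases m with
    | zero =>
      right
      refine ⟨by simp, z, ?_, h0⟩
      obtain ⟨k', rfl⟩ := Nat.exists_eq_add_of_le' hk
      exact h1.lt
    | succ m =>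
      left
      rw [show k + (m + 1) = (k + 1) + m by ring] at h1
      obtain ⟨y, h2, h3⟩ := h1.split
      exact ⟨m + 1, Or.inl ⟨by omega, y, chain_lt hc h2 h0, h3⟩, by push_cast; ring⟩
  · left
    rw [show k + m + 1 = (k + 1) + m by ring] at h1
    obtain ⟨y, h2, h3⟩ := h1.split
    exact ⟨m, Or.inr ⟨x, ⟨y, chain_lt hc h2 h0, h3⟩, hx⟩, by push_cast; ring⟩

/-- concatenation of `A` segments -/
def SW (k : ℕ) : ℕ → X → X → ℤ → Prop
  | 0, y, w, s => y = w ∧ s = 0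
  | A + 1, y, w, s => ∃ v t r, SW k A y v t ∧ Seg k v w r ∧ s = t + r

theorem SW.trans {k A B : ℕ} {x y z : X} {s t : ℤ} (h1 : SW k A x y s) (h2 : SW k B y z t) :
    SW k (A + B) x z (s + t) := by
  induction B generalizing z t with
  | zero => obtain ⟨rfl, rfl⟩ := h2; simpa using h1
  | succ B ih =>
    obtain ⟨v, t', r, h3, h4, rfl⟩ := h2
    exact ⟨v, s + t', r, ih h3, h4, by ring⟩

theorem SW.front {k A : ℕ} {x z : X} {s : ℤ} (h : SW k (A + 1) x z s) :
    ∃ y r t, Seg k x y r ∧ SW k A y z t ∧ s = r + t := by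
  induction A generalizing z s with
  | zero =>
    obtain ⟨v, t, r, ⟨rfl, rfl⟩, h2, rfl⟩ := h
    exact ⟨z, r, 0, h2, ⟨rfl, rfl⟩, by ring⟩
  | succ A ih =>
    obtain ⟨v, t, r, h1, h2, rfl⟩ := h
    obtain ⟨y, r', t', h3, h4, rfl⟩ := ih h1
    exact ⟨y, r', t' + r, h3, ⟨v, t', r, h4, h2, rfl⟩, by ring⟩

theorem SW.single {k : ℕ} {x y : X} {s : ℤ} (h : Seg k x y s) : SW k 1 x y s :=
  ⟨x, 0, s, ⟨rfl, rfl⟩, h, by ring⟩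

theorem SW.append {k A : ℕ} (h22 : ¬ HasInduced22 X) {y w v : X} {s : ℤ} {n : ℕ}
    (h : SW k (A + 1) y w s) (h2 : Desc w v n) : SW k (A + 1) y v (s - n) := by
  obtain ⟨x, t, r, h1, h3, rfl⟩ := h
  exact ⟨x, t, r - n, h1, h3.append h22 h2, by ring⟩

theorem SW.findNonpos {k A : ℕ} {y w : X} {s : ℤ} (h : SW k (A + 1) y w s) (hs : s ≤ 0) :
    ∃ B C p q s1 t s2, SW k B y p s1 ∧ Seg k p q t ∧ SW k C q w s2 ∧ B + C = A ∧
      s = s1 + t + s2 ∧ t ≤ 0 := by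
  induction A generalizing w s with
  | zero =>
    obtain ⟨v, t, r, h1, h2, rfl⟩ := h
    have h1' := h1
    obtain ⟨rfl, rfl⟩ := h1'
    exact ⟨0, 0, y, w, 0, r, 0, h1, h2, ⟨rfl, rfl⟩, rfl, by ring, by omega⟩
  | succ A ih =>
    obtain ⟨v, t, r, h1, h2, rfl⟩ := h
    by_cases hr : r ≤ 0
    · exact ⟨A + 1, 0, v, w, t, r, 0, h1, h2, ⟨rfl, rfl⟩, rfl, by ring, hr⟩
    · obtain ⟨B, C, p, q, s1, t', s2, h3, h4, h5, h6, h7, h8⟩ := ih h1 (by omega)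
      exact ⟨B, C + 1, p, q, s1, t', s2 + r, h3, h4, ⟨v, s2, r, h5, h2, rfl⟩, by omega,
        by rw [h7]; ring, h8⟩

theorem SW.pos {k : ℕ} (hk : 0 < k) (h22 : ¬ HasInduced22 X)
    (hc : ¬ HasInducedChainPlus1 X (k + 2)) (A : ℕ) :
    ∀ (y : X) (s : ℤ), SW k (A + 1) y y s → 0 < s := by
  induction A with
  | zero =>
    intro y s h
    obtain ⟨v, t, r, ⟨rfl, rfl⟩, h2, rfl⟩ := h
    by_contra hs
    rcases h2.reduce hk hc (by omega) with ⟨n, h, _⟩ | ⟨_, z, h, h'⟩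
    · exact descP_irrefl h
    · exact h' h
  | succ A ih =>
    intro y s h
    by_contra hs
    obtain ⟨B, C, p, q, s1, t, s2, h1, h2, h3, h4, h5, h6⟩ := h.findNonpos (by omega)
    have h7 := h3.trans h1
    rw [show C + B = A + 1 by omega] at h7
    rcases h2.reduce hk hc h6 with ⟨n, h, hn⟩ | ⟨h0, z, hz, hz'⟩
    · have := ih _ _ (h7.append h22 h.desc)
      omega
    · obtain ⟨r, t1, t2, h8, h9, h10⟩ := h7.front
      obtain ⟨z', m, h11, h12, h13⟩ := h8
      have h14 : Seg k p r t1 := by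
        refine ⟨z', m, fun h => h11 ?_, h12, h13⟩
        exact ferrers h22 h hz hz'
      have := (SW.single h14).trans h9
      rw [add_comm 1 A] at this
      have := ih _ _ this
      omega

/-- the arcs between left endpoints -/
def arcs (X : Type*) [PartialOrder X] (k : ℕ) : Set (X × X × ℤ) :=
  {q | (q.2.2 = k ∧ ¬ q.1 < q.2.1) ∨ (q.2.2 = 0 ∧ ∃ x, x < q.1 ∧ ¬ x < q.2.1) ∨
    (q.2.2 = -1 ∧ q.2.1 < q.1)}

theorem arc_cases {k : ℕ} {u v : X} {w : ℤ} (h : (u, v, w) ∈ arcs X k) :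
    (∃ n : ℕ, DescP u v n ∧ w = -n) ∨ Seg k u v w := by
  rcases h with ⟨h1, h2⟩ | ⟨h1, x, h2, h3⟩ | ⟨h1, h2⟩
  · exact Or.inr ⟨v, 0, h2, Or.inl rfl, by simpa using h1⟩
  · exact Or.inl ⟨0, Or.inr ⟨x, ⟨x, h2, rfl⟩, h3⟩, by simpa using h1⟩
  · exact Or.inl ⟨1, Or.inl ⟨le_rfl, v, h2, rfl⟩, by simpa using h1⟩

theorem walk_cases {k : ℕ} (h22 : ¬ HasInduced22 X) {u v : X} {w : ℤ}
    (h : Walk (arcs X k) u v w) :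
    (∃ n : ℕ, DescP u v n ∧ w = -n) ∨
      ∃ y n A s, Desc u y n ∧ SW k (A + 1) y v s ∧ w = s - n := by
  induction h with
  | @single v w h =>
    rcases arc_cases h with h | h
    · exact Or.inl h
    · exact Or.inr ⟨u, 0, 0, w, Or.inl rfl, SW.single h, by simp⟩
  | @snoc v w x t _ h ih =>
    rcases arc_cases h with ⟨m, hd, rfl⟩ | h
    · rcases ih with ⟨n, h1, rfl⟩ | ⟨y, n, A, s, h1, h2, rfl⟩
      · exact Or.inl ⟨n + m, h1.trans h22 hd, by push_cast; ring⟩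
      · exact Or.inr ⟨y, n, A, s - m, h1, h2.append h22 hd.desc, by ring⟩
    · rcases ih with ⟨n, h1, rfl⟩ | ⟨y, n, A, s, h1, h2, rfl⟩
      · exact Or.inr ⟨v, n, 0, t, h1.desc, SW.single h, by ring⟩
      · exact Or.inr ⟨y, n, A + 1, s + t, h1, h2.trans (SW.single h), by ring⟩

theorem walk_pos {k : ℕ} (hk : 0 < k) (h22 : ¬ HasInduced22 X)
    (hc : ¬ HasInducedChainPlus1 X (k + 2)) (u : X) (w : ℤ)
    (h : Walk (arcs X k) u u w) : 0 < w := by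
  rcases walk_cases h22 h with ⟨n, h, _⟩ | ⟨y, n, A, s, h1, h2, rfl⟩
  · exact (descP_irrefl h).elim
  · exact SW.pos hk h22 hc _ _ _ (h2.append h22 h1)

theorem arcs_finite [Finite X] (k : ℕ) : (arcs X k).Finite := by
  refine Set.Finite.subset (s := Set.univ ×ˢ (Set.univ ×ˢ ({(k : ℤ), 0, -1} : Set ℤ))) ?_ ?_
  · exact Set.finite_univ.prod (Set.finite_univ.prod (Set.toFinite _))
  · rintro ⟨u, v, w⟩ h
    simp only [Set.mem_prod, Set.mem_univ, true_and, Set.mem_insert_iff, Set.mem_singleton_iff]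
    rcases h with h | h | h
    · exact Or.inl h.1
    · exact Or.inr (Or.inl h.1)
    · exact Or.inr (Or.inr h.1)

theorem backward [Fintype X] {k : ℕ} (hk : 0 < k) (h22 : ¬ HasInduced22 X)
    (hc : ¬ HasInducedChainPlus1 X (k + 2)) : HasIntervalRep1k X k := by
  classical
  obtain ⟨L, hL⟩ := exists_potential (Finset.univ : Finset X) (arcs X k) (arcs_finite k)
    (walk_pos hk h22 hc)
  have ha : ∀ u v, ¬ u < v → L v < L u + k := fun u v h => by
    simpa using hL u v k (Or.inl ⟨rfl, h⟩) (Finset.mem_univ _) (Finset.mem_univ _)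
  have hb : ∀ u v x, x < u → ¬ x < v → L v < L u := fun u v x h h' => by
    simpa using hL u v 0 (Or.inr (Or.inl ⟨rfl, x, h, h'⟩)) (Finset.mem_univ _) (Finset.mem_univ _)
  have hcc : ∀ u v, v < u → L v + 1 < L u := fun u v h => by
    have := hL u v (-1) (Or.inr (Or.inr ⟨rfl, h⟩)) (Finset.mem_univ _) (Finset.mem_univ _)
    push_cast at this
    linarith
  have hne : ∀ x : X, (Finset.univ.filter fun y => ¬ x < y).Nonempty := fun x =>
    ⟨x, by simp⟩
  let M : X → ℝ := fun x => (Finset.univ.filter fun y => ¬ x < y).sup' (hne x) L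
  have hM : ∀ x y, ¬ x < y → L y ≤ M x := fun x y h =>
    Finset.le_sup' L (by simp [h])
  have hM' : ∀ x c, (∀ y, ¬ x < y → L y < c) → M x < c := fun x c h => by
    refine (Finset.sup'_lt_iff _).2 ?_
    intro y hy
    exact h y (Finset.mem_filter.1 hy).2
  have hk1 : (1 : ℝ) ≤ k := by exact_mod_cast hk
  refine ⟨L, fun x => max (L x + 1) (M x), ⟨fun x => ?_, fun x y => ⟨fun h => ?_, fun h => ?_⟩⟩,
    fun x => ⟨?_, ?_⟩⟩
  · exact le_trans (by linarith) (le_max_left _ _)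
  · exact max_lt (hcc _ _ h) (hM' _ _ fun z hz => hb _ _ x h hz)
  · by_contra h'
    exact absurd (hM x y h') (not_le.2 ((le_max_right _ _).trans_lt h))
  · have := le_max_left (L x + 1) (M x)
    linarith
  · have : max (L x + 1) (M x) ≤ L x + k :=
      max_le (by linarith) (hM' _ _ fun z hz => ha _ _ hz).le
    linarith

theorem forward {k : ℕ} (h : HasIntervalRep1k X k) :
    ¬ HasInduced22 X ∧ ¬ HasInducedChainPlus1 X (k + 2) := by
  obtain ⟨L, R, ⟨_, hlt⟩, hlen⟩ := h
  refine ⟨?_, ?_⟩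
  · rintro ⟨a, b, c, d, h1, h2, _, h3, h4, _⟩
    have e1 := (hlt _ _).1 h1
    have e2 := (hlt _ _).1 h2
    have e3 := not_lt.1 (fun h => h3.2.1 ((hlt _ _).2 h))
    have e4 := not_lt.1 (fun h => h4.2.1 ((hlt _ _).2 h))
    linarith
  · rintro ⟨a, x, hch, hx⟩
    have key : ∀ i, i ≤ k → L (a 1) + i ≤ L (a (i + 1)) := by
      intro i
      induction i with
      | zero => intro _; simp
      | succ i ih =>
        intro hi
        have e1 := ih (by omega)
        have e2 := (hlt _ _).1 (hch (i + 1) (i + 1 + 1) (by omega) (by omega))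
        have e3 := (hlen (a (i + 1))).1
        push_cast
        linarith
    have e1 := key k le_rfl
    have e2 := (hlt _ _).1 (hch 0 1 (by omega) (by omega))
    have e3 := not_lt.1 (fun h => (hx 0 (by omega)).2.2 ((hlt _ _).2 h))
    have e4 := not_lt.1 (fun h => (hx (k + 1) (by omega)).2.1 ((hlt _ _).2 h))
    have e5 := (hlen x).2
    linarith

end poset

end FishburnAux

/-- Fishburn's theorem: a finite poset has an interval representation with all
interval lengths in `[1, k]` iff it contains no induced `2+2` and no induced
`(k+2)+1`. -/
theorem hasIntervalRep1k_iff_no_22_no_kPlus2Plus1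
    {X : Type*} [Fintype X] [PartialOrder X] (k : ℕ) (hk : 0 < k) :
    HasIntervalRep1k X k ↔ ¬ HasInduced22 X ∧ ¬ HasInducedChainPlus1 X (k + 2) :=
  ⟨FishburnAux.forward, fun h => FishburnAux.backward hk h.1 h.2⟩
end

section
/- Let P = (X, ≺) be a finite poset, k a positive integer, and ε a real number with 0 < ε < 1/(2|X|). If P contains no induced 2+2 and no induced (k+2)+1, then the weighted digraph G_{P,k} contains no negative cycle. -/
section Aux

variable {X : Type*} [PartialOrder X]

/-- Walks on right endpoints: `AWalk k e c n t` is a walk from `r_c` to `r_e` with `n`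
composite steps and integer weight `t`. -/
inductive AWalk (k : ℕ) (e : X) : X → ℕ → ℤ → Prop
  | nil : AWalk k e e 0 0
  | stepK {c x : X} {n : ℕ} {t : ℤ} : Incomp c x → AWalk k e x n t → AWalk k e c (n + 1) (t + k)
  | stepU {c d : X} {n : ℕ} {t : ℤ} : d < c → AWalk k e d n t → AWalk k e c (n + 1) (t - 1)
  | stepZ {c b d : X} {n : ℕ} {t : ℤ} :
      Incomp c b → d < b → AWalk k e d n t → AWalk k e c (n + 1) t

theorem AWalk.cast {k : ℕ} {e c : X} {n n' : ℕ} {t t' : ℤ} (h : AWalk k e c n t)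
    (hn : n = n') (ht : t = t') : AWalk k e c n' t' := by
  subst hn ht; exact h

theorem AWalk.trans {k : ℕ} {a b c : X} {n m : ℕ} {s t : ℤ} (h : AWalk k b c n s)
    (h' : AWalk k a b m t) : AWalk k a c (n + m) (s + t) := by
  induction h with
  | nil => simpa using h'
  | stepK hi _ ih => exact (AWalk.stepK hi ih).cast (by omega) (by omega)
  | stepU hi _ ih => exact (AWalk.stepU hi ih).cast (by omega) (by omega)
  | stepZ hi hd _ ih => exact (AWalk.stepZ hi hd ih).cast (by omega) (by omega)

theorem below_of_no22 (h22 : ¬ HasInduced22 X) {q p d q' : X} (h1 : q < p) (h2 : Incomp q d)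
    (h3 : q' < d) : q' < p := by
  by_contra hn
  obtain ⟨e1, e2, e3⟩ := h2
  refine h22 ⟨q, q', p, d, h1, h3, ⟨?_, ?_, ?_⟩, ⟨e1, e2, e3⟩, ⟨?_, hn, ?_⟩, ⟨?_, ?_, ?_⟩⟩
  · rintro rfl; exact hn h1
  · intro h; exact e2 (h.trans h3)
  · intro h; exact hn (h.trans h1)
  · rintro rfl; exact e2 (h1.trans h3)
  · intro h; exact e2 (h1.trans (h.trans h3))
  · rintro rfl; exact e2 h1
  · intro h; exact e2 (h1.trans h)
  · intro h; exact hn (h3.trans h)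

/-- Descending chains of elements incomparable to `x`, ending at the given element. -/
inductive DChain (x : X) : X → ℕ → Prop
  | one {y : X} : Incomp x y → DChain x y 1
  | step {q q' : X} {h : ℕ} : DChain x q h → q' < q → Incomp x q' → DChain x q' (h + 1)

theorem DChain.incomp {x q : X} {h : ℕ} (H : DChain x q h) : Incomp x q := by
  cases H <;> assumption

theorem DChain.exists_fun {x q : X} {h : ℕ} (H : DChain x q h) :
    ∃ a : ℕ → X, a 0 = q ∧ (∀ i j, i < j → j < h → a i < a j) ∧ ∀ i < h, Incomp x (a i) := by
  induction H with
  | one hy => exact ⟨fun _ => _, rfl, fun i j h1 h2 => by omega, fun _ _ => hy⟩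
  | @step q q' h _ hlt hi ih =>
    obtain ⟨a, h0, h1, h2⟩ := ih
    refine ⟨fun i => Nat.casesOn i q' a, rfl, ?_, ?_⟩
    · intro i j hij hj
      obtain ⟨j, rfl⟩ : ∃ j', j = j' + 1 := ⟨j - 1, by omega⟩
      cases i with
      | zero =>
        refine lt_of_lt_of_le hlt ?_
        rw [← h0]
        rcases Nat.eq_zero_or_pos j with rfl | hj0
        · exact le_rfl
        · exact (h1 0 j hj0 (by omega)).le
      | succ i => exact h1 i j (by omega) (by omega)
    · intro i hi'
      cases i with
      | zero => exact hi
      | succ i => exact h2 i (by omega)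

theorem DChain.le {k : ℕ} (hk21 : ¬ HasInducedChainPlus1 X (k + 2)) {x q : X} {h : ℕ}
    (H : DChain x q h) : h ≤ k + 1 := by
  by_contra hc
  obtain ⟨a, _, h1, h2⟩ := H.exists_fun
  exact hk21 ⟨a, x, fun i j hij hj => h1 i j hij (by omega), fun i hi => h2 i (by omega)⟩

theorem incomp_or_lt {x p q : X} (hx : Incomp x p) (h : q < p) : Incomp x q ∨ q < x := by
  by_cases hq : q < x
  · exact Or.inr hq
  · refine Or.inl ⟨?_, ?_, hq⟩
    · rintro rfl; exact hx.2.1 h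
    · intro h'; exact hx.2.1 (h'.trans h)

theorem Incomp.symm' {x y : X} (h : Incomp x y) : Incomp y x := ⟨h.1.symm, h.2.2, h.2.1⟩

/-- Either the walk goes only to the left, or it has a `k`-step. -/
theorem AWalk.split {k : ℕ} (h22 : ¬ HasInduced22 X) {e c : X} {n : ℕ} {t : ℤ}
    (H : AWalk k e c n t) :
    (∃ p q n1 n2 t1 t2, AWalk k p c n1 t1 ∧ Incomp p q ∧ AWalk k e q n2 t2 ∧
      n1 + n2 + 1 = n ∧ t1 + k + t2 = t) ∨ (n = 0 ∧ c = e) ∨ e < c ∨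
      ∃ b, Incomp c b ∧ e < b := by
  induction H with
  | nil => simp
  | @stepK c x n t hi hw ih =>
    exact Or.inl ⟨c, x, 0, n, 0, t, .nil, hi, hw, by omega, by omega⟩
  | @stepU c d n t hd hw ih =>
    rcases ih with ⟨p, q, n1, n2, t1, t2, w1, hi, w2, hn, ht⟩ | ⟨_, rfl⟩ | h | ⟨b, hb, h⟩
    · exact Or.inl ⟨p, q, n1 + 1, n2, t1 - 1, t2, .stepU hd w1, hi, w2, by omega, by omega⟩
    · exact Or.inr (Or.inr (Or.inl hd))
    · exact Or.inr (Or.inr (Or.inl (h.trans hd)))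
    · exact Or.inr (Or.inr (Or.inl (below_of_no22 h22 hd hb h)))
  | @stepZ c b d n t hb' hd hw ih =>
    rcases ih with ⟨p, q, n1, n2, t1, t2, w1, hi, w2, hn, ht⟩ | ⟨_, rfl⟩ | h | ⟨b', hb, h⟩
    · exact Or.inl ⟨p, q, n1 + 1, n2, t1, t2, .stepZ hb' hd w1, hi, w2, by omega, by omega⟩
    · exact Or.inr (Or.inr (Or.inr ⟨b, hb', hd⟩))
    · exact Or.inr (Or.inr (Or.inr ⟨b, hb', h.trans hd⟩))
    · exact Or.inr (Or.inr (Or.inr ⟨b, hb', below_of_no22 h22 hd hb h⟩))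

/-- State of the one-pass scan of a closed walk. -/
def ScanState (k : ℕ) (a q : X) (i : ℕ) (s : ℤ) : Prop :=
  AWalk k q a i s ∧ ∃ c x i0 s0, AWalk k c a i0 s0 ∧ Incomp c x ∧ 0 ≤ s0 ∧ i0 + 1 ≤ i ∧
    ((q = x ∧ s0 + k ≤ s) ∨ ∃ h : ℕ, 2 ≤ h ∧ DChain x q h ∧ s0 + k - (h - 2) ≤ s)

theorem ScanState.one_le {k : ℕ} (hk : 0 < k) (hk21 : ¬ HasInducedChainPlus1 X (k + 2))
    {a q : X} {i : ℕ} {s : ℤ} (H : ScanState k a q i s) : 1 ≤ s := by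
  obtain ⟨_, c, x, i0, s0, _, _, h0, _, ⟨_, h⟩ | ⟨h, h2, hc, hs⟩⟩ := H
  · omega
  · have := hc.le hk21
    omega

theorem scan {k : ℕ} (hk : 0 < k) (h22 : ¬ HasInduced22 X)
    (hk21 : ¬ HasInducedChainPlus1 X (k + 2)) (N : ℕ)
    (IH : ∀ m < N, ∀ (a : X) (t : ℤ), 0 < m → AWalk k a a m t → 1 ≤ t)
    {a q : X} {j : ℕ} {s' : ℤ} (W : AWalk k a q j s') :
    ∀ (i : ℕ) (s : ℤ), ScanState k a q i s → i + j = N → 1 ≤ s + s' := by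
  induction W with
  | nil => intro i s H _; have := H.one_le hk hk21; omega
  | @stepK c x n t hi hw ih =>
    intro i s H hN
    have h1 := H.one_le hk hk21
    have := ih (i + 1) (s + k) ⟨(H.1.trans (AWalk.stepK hi .nil)).cast (by omega) (by omega),
      c, x, i, s, H.1, hi, by omega, le_rfl, Or.inl ⟨rfl, le_rfl⟩⟩ (by omega)
    omega
  | @stepU q d n t hd hw ih =>
    intro i s H hN
    obtain ⟨w, c, x, i0, s0, w0, hcx, h0, hi0, hst⟩ := H
    have short : d < x → s0 ≤ s - 1 → 1 ≤ s + (t - 1) := by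
      intro hdx hs
      have := IH _ (by omega) a _ (by omega) (w0.trans (AWalk.stepZ hcx hdx hw))
      omega
    rcases hst with ⟨rfl, hs⟩ | ⟨h, h2, hc, hs⟩
    · exact short hd (by omega)
    · have := hc.le hk21
      rcases incomp_or_lt hc.incomp hd with hx | hx
      · have := ih (i + 1) (s - 1) ⟨(w.trans (AWalk.stepU hd .nil)).cast (by omega) (by omega), c, x, i0, s0, w0, hcx, h0, by omega,
          Or.inr ⟨h + 1, by omega, .step hc hd hx, by push_cast; omega⟩⟩ (by omega)
        omega
      · exact short hx (by omega)
  | @stepZ q b d n t hb hd hw ih =>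
    intro i s H hN
    obtain ⟨w, c, x, i0, s0, w0, hcx, h0, hi0, hst⟩ := H
    have short : d < x → s0 ≤ s → 1 ≤ s + t := by
      intro hdx hs
      have := IH _ (by omega) a _ (by omega) (w0.trans (AWalk.stepZ hcx hdx hw))
      omega
    rcases hst with ⟨rfl, hs⟩ | ⟨h, h2, hc, hs⟩
    · rcases incomp_or_lt hb hd with hx | hx
      · exact ih (i + 1) s ⟨(w.trans (AWalk.stepZ hb hd .nil)).cast (by omega) (by omega), c, q, i0, s0, w0, hcx, h0, by omega,
          Or.inr ⟨2, le_rfl, .step (.one hb) hd hx, by push_cast; omega⟩⟩ (by omega)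
      · exact short hx (by omega)
    · have := hc.le hk21
      cases hc with
      | one _ => omega
      | @step p _ h hp hlt hi =>
        have hdp : d < p := below_of_no22 h22 hlt hb hd
        rcases incomp_or_lt hp.incomp hdp with hx | hx
        · exact ih (i + 1) s ⟨(w.trans (AWalk.stepZ hb hd .nil)).cast (by omega) (by omega), c, x, i0, s0, w0, hcx, h0, by omega,
            Or.inr ⟨h + 1, h2, .step hp hdp hx, hs⟩⟩ (by omega)
        · exact short hx (by push_cast at *; omega)

theorem AWalk.closed_one_le {k : ℕ} (hk : 0 < k) (h22 : ¬ HasInduced22 X)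
    (hk21 : ¬ HasInducedChainPlus1 X (k + 2)) (N : ℕ) :
    ∀ (a : X) (t : ℤ), 0 < N → AWalk k a a N t → 1 ≤ t := by
  induction N using Nat.strong_induction_on with
  | _ N IH =>
    intro a t hN W
    rcases W.split h22 with ⟨p, q, n1, n2, t1, t2, w1, hi, w2, hn, ht⟩ | ⟨h, _⟩ | h | ⟨b, hb, h⟩
    · have := scan hk h22 hk21 N IH (w2.trans w1) 1 k
        ⟨(AWalk.stepK hi .nil).cast (by omega) (by omega), p, q, 0, 0, .nil, hi, le_rfl, le_rfl,
          Or.inl ⟨rfl, by omega⟩⟩ (by omega)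
      omega
    · omega
    · exact absurd h (lt_irrefl _)
    · exact absurd h hb.2.1

variable [DecidableEq X]

theorem walk_of_seq (k : ℕ) (hk : 0 < k) (ε : ℝ) (v : ℕ → X ⊕ X)
    (hv : ∀ i, (GPk X k ε).Adj (v i) (v (i + 1))) (a : X) (ha : v 0 = Sum.inr a) (m : ℕ) :
    ∃ c n t, v (2 * m) = Sum.inr c ∧ AWalk k c a n t ∧
      (t : ℝ) ≤ ∑ i ∈ Finset.range (2 * m), (GPk X k 0).w (v i) (v (i + 1)) ∧
      (n = 0 → ∑ i ∈ Finset.range (2 * m), (GPk X k ε).w (v i) (v (i + 1)) =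
        ∑ i ∈ Finset.range (2 * m), (GPk X k 0).w (v i) (v (i + 1))) := by
  have hk1 : (1 : ℝ) ≤ k := by exact_mod_cast hk
  induction m with
  | zero => exact ⟨a, 0, 0, by simpa using ha, .nil, by simp, by simp⟩
  | succ m ih =>
    obtain ⟨c, n, t, hc, W, ht, hn⟩ := ih
    have h1 := hv (2 * m)
    have h2 := hv (2 * m + 1)
    rw [show 2 * (m + 1) = 2 * m + 1 + 1 by ring]
    simp only [Finset.sum_range_succ]
    generalize ∑ i ∈ Finset.range (2 * m), (GPk X k ε).w (v i) (v (i + 1)) = S at *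
    generalize ∑ i ∈ Finset.range (2 * m), (GPk X k 0).w (v i) (v (i + 1)) = S0 at *
    rw [hc] at h1 ⊢
    rcases hb : v (2 * m + 1) with b | b
    swap
    · rw [hb] at h1; exact h1.elim
    rw [hb] at h1 h2
    rcases hd : v (2 * m + 1 + 1) with d | d
    · rw [hd] at h2; exact h2.elim
    rw [hd] at h2
    change Incomp c b ∨ c = b at h1
    change d < b ∨ d = b at h2
    simp only [GPk]
    rcases h1 with h1 | rfl <;> rcases h2 with h2 | rfl
    · refine ⟨d, n + 1, t, rfl, (W.trans (AWalk.stepZ h1 h2 .nil)).cast (by omega) (by omega),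
        ?_, by omega⟩
      simp only [h1.1, h2.ne, if_false]; linarith
    · refine ⟨d, n + 1, t + k, rfl, (W.trans (AWalk.stepK h1 .nil)).cast (by omega) (by omega),
        ?_, by omega⟩
      simp only [h1.1, if_false, if_true]; push_cast; linarith
    · refine ⟨d, n + 1, t - 1, rfl, (W.trans (AWalk.stepU h2 .nil)).cast (by omega) (by omega),
        ?_, by omega⟩
      simp only [h2.ne, if_false, if_true]; push_cast; linarith
    · refine ⟨d, n, t, rfl, W, ?_, ?_⟩
      · simp only [if_true]; linarith
      · intro h; simp only [if_true]; rw [hn h]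

theorem closed_seq (k : ℕ) (hk : 0 < k) (ε : ℝ) (h22 : ¬ HasInduced22 X)
    (hk21 : ¬ HasInducedChainPlus1 X (k + 2)) (v : ℕ → X ⊕ X)
    (hv : ∀ i, (GPk X k ε).Adj (v i) (v (i + 1))) (a : X) (ha : v 0 = Sum.inr a) (L : ℕ)
    (hL : v L = Sum.inr a) :
    1 ≤ ∑ i ∈ Finset.range L, (GPk X k 0).w (v i) (v (i + 1)) ∨
      0 ≤ ∑ i ∈ Finset.range L, (GPk X k ε).w (v i) (v (i + 1)) := by
  obtain ⟨m, rfl | rfl⟩ := L.even_or_odd'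
  · obtain ⟨c, n, t, hc, W, ht, hn⟩ := walk_of_seq k hk ε v hv a ha m
    rw [hL] at hc
    obtain rfl : a = c := by simpa using hc
    rcases Nat.eq_zero_or_pos n with rfl | hpos
    · right
      rw [hn rfl]
      cases W
      simpa using ht
    · left
      have := W.closed_one_le hk h22 hk21 n a t hpos
      have : (1 : ℝ) ≤ t := by exact_mod_cast this
      linarith
  · obtain ⟨c, n, t, hc, W, ht, hn⟩ := walk_of_seq k hk ε v hv a ha m
    have := hv (2 * m)
    rw [hc, hL] at this
    exact this.elim

theorem w_lower (k : ℕ) (ε : ℝ) (hε : 0 < ε) (u v : X ⊕ X) :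
    (GPk X k 0).w u v - ε * (if u.isLeft then 1 else 0) ≤ (GPk X k ε).w u v := by
  rcases u with u | u <;> rcases v with v | v <;> simp [GPk]
  · exact hε.le
  · split_ifs <;> linarith

end Aux

/-- If `P` contains no induced `2+2` and no induced `(k+2)+1`, then `G_{P,k}`
contains no negative cycle. -/
theorem no_negCycle_of_no_22_no_kPlus2Plus1
    {X : Type*} [Fintype X] [PartialOrder X] [DecidableEq X] (k : ℕ) (hk : 0 < k)
    (ε : ℝ) (hε0 : 0 < ε) (hε1 : ε < 1 / (2 * Fintype.card X))
    (h22 : ¬ HasInduced22 X) (hk21 : ¬ HasInducedChainPlus1 X (k + 2)) :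
    ¬ (GPk X k ε).HasNegCycle := by
  rintro ⟨c, ⟨hne, hnd, hadj⟩, hw⟩
  have hL : 0 < c.length := List.length_pos_iff.2 hne
  set L := c.length with hLdef
  let v : ℕ → X ⊕ X := fun i => c.get ⟨i % L, Nat.mod_lt _ hL⟩
  have hvv : ∀ i (hi : i < L), v i = c.get ⟨i, hi⟩ := by
    intro i hi; simp only [v, Nat.mod_eq_of_lt hi]
  have hvs : ∀ i (hi : i < L), v (i + 1) = c.get (finNext ⟨i, hi⟩) := by
    intro i hi; rfl
  have hper : ∀ i, v (i + L) = v i := by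
    intro i; simp only [v, Nat.add_mod_right]
  have hmod : ∀ i, v i = v (i % L) := by
    intro i; simp only [v, Nat.mod_mod]
  have hmod1 : ∀ i, v (i + 1) = v (i % L + 1) := by
    intro i; simp only [v, Nat.mod_add_mod]
  have hv : ∀ i, (GPk X k ε).Adj (v i) (v (i + 1)) := by
    intro i
    have hi := Nat.mod_lt i hL
    rw [hmod i, hmod1 i, hvv _ hi, hvs _ hi]
    exact hadj _
  have hsum : ∀ δ : ℝ, (GPk X k δ).cycleWeight c =
      ∑ i ∈ Finset.range L, (GPk X k δ).w (v i) (v (i + 1)) := by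
    intro δ
    rw [Finset.sum_range]
    refine Finset.sum_congr rfl fun i _ => ?_
    rw [hvv _ i.2, hvs _ i.2]
  have key : 1 ≤ (GPk X k 0).cycleWeight c ∨ 0 ≤ (GPk X k ε).cycleWeight c := by
    rw [hsum, hsum]
    rcases h0 : v 0 with b | a
    · rcases h1 : v 1 with b' | a
      · have := hv 0
        rw [h0, h1] at this
        exact this.elim
      · have hshift : ∀ δ : ℝ, ∑ i ∈ Finset.range L, (GPk X k δ).w (v i) (v (i + 1)) =
            ∑ i ∈ Finset.range L, (GPk X k δ).w (v (i + 1)) (v (i + 1 + 1)) := by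
          intro δ
          have e1 := Finset.sum_range_succ (fun i => (GPk X k δ).w (v i) (v (i + 1))) L
          have e2 := Finset.sum_range_succ' (fun i => (GPk X k δ).w (v i) (v (i + 1))) L
          have e3 : v L = v 0 := by simpa using hper 0
          have e4 : v (L + 1) = v (0 + 1) := by simpa [add_comm] using hper 1
          rw [e3, e4] at e1
          linarith
        rw [hshift, hshift]
        exact closed_seq k hk ε h22 hk21 (fun i => v (i + 1)) (fun i => hv (i + 1)) a h1 L
          (by simpa [add_comm, h1] using hper 1)
    · exact closed_seq k hk ε h22 hk21 v hv a h0 L (by simpa [h0] using hper 0)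
  rcases key with key | key
  swap
  · linarith
  have hcount : ∑ i : Fin c.length, (if (c.get i).isLeft then (1 : ℝ) else 0) ≤ Fintype.card X := by
    have hinj : Function.Injective c.get := List.nodup_iff_injective_get.1 hnd
    have e1 : ∑ i : Fin c.length, (if (c.get i).isLeft then (1 : ℝ) else 0) =
        ∑ u ∈ Finset.univ.map ⟨c.get, hinj⟩, (if u.isLeft then (1 : ℝ) else 0) := by
      rw [Finset.sum_map]; rfl
    rw [e1]
    refine (Finset.sum_le_sum_of_subset_of_nonneg (Finset.subset_univ _) ?_).trans ?_
    · intro u _ _; split_ifs <;> norm_num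
    · rw [Fintype.sum_sum_type]; simp
  have hlow : (GPk X k 0).cycleWeight c -
      ε * ∑ i : Fin c.length, (if (c.get i).isLeft then (1 : ℝ) else 0) ≤
      (GPk X k ε).cycleWeight c := by
    unfold WeightedDigraph.cycleWeight
    rw [Finset.mul_sum, ← Finset.sum_sub_distrib]
    exact Finset.sum_le_sum fun i _ => w_lower k ε hε0 _ _
  have hmul := mul_le_mul_of_nonneg_left hcount hε0.le
  have hX : (0 : ℝ) < Fintype.card X := by
    rcases Nat.eq_zero_or_pos (Fintype.card X) with h | h
    · rw [h] at hε1; norm_num at hε1; linarith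
    · exact_mod_cast h
  rw [lt_div_iff₀ (by positivity)] at hε1
  linarith
end
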